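/- arXiv:1911.10863 — 9 statements merged into one kernel-verified Lean document; each statement's English description precedes it below -/
import Mathlib

section
/- There exists a constant c > 0 such that every finite simple graph G that contains the wheel graph on ν vertices (ν ≥ 4) as a subgraph satisfies mcc_2(G) ≥ c·√ν. -/
/-- The subgraph of `G` keeping only edges between vertices of the same color. -/
def monoSubgraph {V : Type*} {α : Type*} (G : SimpleGraph V) (c : V → α) : SimpleGraph V :=
  SimpleGraph.fromRel (fun a b => G.Adj a b ∧ c a = c b)

/-- The monochromatic connected component of `v` under the coloring `c`. -/
def monoComponent {V : Type*} {α : Type*} (G : SimpleGraph V) (c : V → α) (v : V) : Set V :=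
  {u | (monoSubgraph G c).Reachable v u}

/-- The wheel graph with `m` rim vertices (so `m + 1` vertices total):
a cycle on `ZMod m` together with a hub `none` adjacent to every rim vertex. -/
def wheelGraph (m : ℕ) : SimpleGraph (Option (ZMod m)) :=
  SimpleGraph.fromRel (fun u v =>
    match u, v with
    | none, some _ => True
    | some i, some j => j = i + 1
    | _, _ => False)

/-- There is a constant `c > 0` such that every finite simple graph `G` containing the
wheel on `ν ≥ 4` vertices as a subgraph satisfies: in every 2-coloring of `G`, some
monochromatic connected component has at least `c * √ν` vertices. -/
theorem wheel_subgraph_mcc2_lower :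
    ∃ c : ℝ, 0 < c ∧
      ∀ (V : Type) [Fintype V] (G : SimpleGraph V) (ν : ℕ), 4 ≤ ν →
        (∃ f : Option (ZMod (ν - 1)) → V, Function.Injective f ∧
          ∀ u v, (wheelGraph (ν - 1)).Adj u v → G.Adj (f u) (f v)) →
        ∀ col : V → Fin 2,
          ∃ v : V, c * Real.sqrt ν ≤ ((monoComponent G col v).ncard : ℝ) := by
  refine ⟨1, one_pos, ?_⟩
  intro V _ G ν hν ⟨f, hf, hadj⟩ col
  obtain ⟨v, -, hv⟩ := Finset.exists_max_image (Finset.univ : Finset V)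
    (fun v => (monoComponent G col v).ncard) ⟨f none, Finset.mem_univ _⟩
  refine ⟨v, ?_⟩
  generalize (monoComponent G col v).ncard = K at hv ⊢
  have hK : ∀ u, (monoComponent G col u).ncard ≤ K := fun u => hv u (Finset.mem_univ _)
  suffices h : ν ≤ K ^ 2 by
    rw [one_mul]
    apply Real.sqrt_le_iff.2
    exact ⟨by positivity, by exact_mod_cast h⟩
  obtain ⟨m, rfl⟩ : ∃ m, ν = m + 1 := ⟨ν - 1, by omega⟩
  change Option (ZMod m) → V at f
  have hm : 3 ≤ m := by omega
  by_cases hmK : m ≤ K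
  · nlinarith
  push Not at hmK
  have : NeZero m := ⟨by omega⟩
  have : Fact (1 < m) := ⟨by omega⟩
  have hmono : ∀ a b, (wheelGraph m).Adj a b → col (f a) = col (f b) →
      (monoSubgraph G col).Adj (f a) (f b) := by
    intro a b h1 h2
    have h3 := hadj a b h1
    exact (SimpleGraph.fromRel_adj _ _ _).2 ⟨h3.ne, Or.inl ⟨h3, h2⟩⟩
  let A : Finset (ZMod m) := Finset.univ.filter (fun i => col (f (some i)) = col (f none))
  have hA : A.card + 1 ≤ K := by
    refine le_trans ?_ (hK (f none))
    have hsub : (((Finset.insertNone A).map ⟨f, hf⟩ : Finset V) : Set V) ⊆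
        monoComponent G col (f none) := by
      intro x hx
      simp only [Finset.coe_map, Function.Embedding.coeFn_mk, Set.mem_image,
        Finset.mem_coe] at hx
      obtain ⟨o, ho, rfl⟩ := hx
      rcases o with _ | i
      · exact SimpleGraph.Reachable.refl _
      · have hi : i ∈ A := by simpa using ho
        have hc : col (f (some i)) = col (f none) := (Finset.mem_filter.1 hi).2
        refine (hmono none (some i) ?_ hc.symm).reachable
        simp [wheelGraph]
    have := Set.ncard_le_ncard hsub (Set.toFinite _)
    rw [Set.ncard_coe_finset, Finset.card_map, Finset.card_insertNone] at this
    exact this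
  have hcov : ∀ i : ZMod m, ∃ j ∈ Finset.range (K + 1), i + (j : ZMod m) ∈ A := by
    intro i
    by_contra! hcon
    have hcol : ∀ j < K + 1, col (f (some (i + (j : ZMod m)))) ≠ col (f none) := by
      intro j hj h
      exact hcon j (Finset.mem_range.2 hj) (Finset.mem_filter.2 ⟨Finset.mem_univ _, h⟩)
    have hreach : ∀ j < K + 1,
        (monoSubgraph G col).Reachable (f (some i)) (f (some (i + (j : ZMod m)))) := by
      intro j
      induction j with
      | zero => intro _; simp
      | succ j ih =>
        intro hj
        refine (ih (by omega)).trans (SimpleGraph.Adj.reachable (hmono _ _ ?_ ?_))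
        · refine (SimpleGraph.fromRel_adj _ _ _).2 ⟨?_, Or.inl ?_⟩
          · intro h
            have h := Option.some.inj h
            push_cast at h
            rw [← add_assoc] at h
            simp at h
          · push_cast
            ring
        · have h1 := hcol j (by omega)
          have h2 := hcol (j + 1) hj
          omega
    have hinj : Set.InjOn (fun j : ℕ => f (some (i + (j : ZMod m))))
        (Finset.range (K + 1) : Finset ℕ) := by
      intro a ha b hb hab
      have h := add_left_cancel (Option.some.inj (hf hab))
      have ha := Finset.mem_range.1 (Finset.mem_coe.1 ha)
      have hb := Finset.mem_range.1 (Finset.mem_coe.1 hb)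
      rw [ZMod.natCast_eq_natCast_iff'] at h
      rwa [Nat.mod_eq_of_lt (by omega), Nat.mod_eq_of_lt (by omega)] at h
    have hsub : (fun j : ℕ => f (some (i + (j : ZMod m)))) ''
        (Finset.range (K + 1) : Finset ℕ) ⊆ monoComponent G col (f (some i)) := by
      rintro _ ⟨j, hj, rfl⟩
      exact hreach j (Finset.mem_range.1 (Finset.mem_coe.1 hj))
    have h1 := Set.ncard_le_ncard hsub (Set.toFinite _)
    rw [Set.ncard_image_of_injOn hinj, Set.ncard_coe_finset, Finset.card_range] at h1
    have := hK (f (some i))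
    omega
  have hcard : m ≤ A.card * (K + 1) := by
    classical
    have h1 : (Finset.univ : Finset (ZMod m)) ⊆
        (A ×ˢ Finset.range (K + 1)).image (fun p => p.1 - (p.2 : ZMod m)) := by
      intro i _
      obtain ⟨j, hj, h⟩ := hcov i
      exact Finset.mem_image.2 ⟨(i + j, j), Finset.mem_product.2 ⟨h, hj⟩, by simp⟩
    have h2 := (Finset.card_le_card h1).trans Finset.card_image_le
    rwa [Finset.card_univ, ZMod.card, Finset.card_product, Finset.card_range] at h2
  nlinarith
end

section
/- There exists a constant c > 0 such that for every integer n ≥ 5 and every 3-coloring of the vertices of the double wheel D on n vertices in which the two central vertices receive different colors, some monochromatic connected component of D has at least c·√n vertices. -/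
/-- The double wheel with `m` rim vertices (so `m + 2` vertices total): a cycle on
`ZMod m` together with two hubs `Sum.inr 0` and `Sum.inr 1`, each adjacent to every rim
vertex; the two hubs are not adjacent to each other. -/
def doubleWheelGraph (m : ℕ) : SimpleGraph (ZMod m ⊕ Fin 2) :=
  SimpleGraph.fromRel (fun u v =>
    match u, v with
    | Sum.inr _, Sum.inl _ => True
    | Sum.inl i, Sum.inl j => j = i + 1
    | _, _ => False)


theorem mono_rim_adj {m : ℕ} (hm : 3 ≤ m) (col : (ZMod m ⊕ Fin 2) → Fin 3) (i j : ZMod m)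
    (hj : i = j + 1) (h : col (Sum.inl i) = col (Sum.inl j)) :
    (monoSubgraph (doubleWheelGraph m) col).Adj (Sum.inl i) (Sum.inl j) := by
  haveI : Fact (1 < m) := ⟨by omega⟩
  have hne : i ≠ j := by
    subst hj
    simp
  simp [monoSubgraph, doubleWheelGraph, SimpleGraph.fromRel_adj, hne, hj]
  rw [← hj, h]
  simp

theorem mono_hub_adj {m : ℕ} (col : (ZMod m ⊕ Fin 2) → Fin 3) (i : ZMod m) (k : Fin 2)
    (h : col (Sum.inl i) = col (Sum.inr k)) :
    (monoSubgraph (doubleWheelGraph m) col).Adj (Sum.inr k) (Sum.inl i) := by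
  simp [monoSubgraph, doubleWheelGraph, SimpleGraph.fromRel_adj, h]

theorem dw_aux {m : ℕ} (hm : 3 ≤ m) (col : (ZMod m ⊕ Fin 2) → Fin 3)
    (hc : col (Sum.inr 0) ≠ col (Sum.inr 1)) (s : ℕ)
    (hs : ∀ v, (monoComponent (doubleWheelGraph m) col v).ncard ≤ s) : m + 2 ≤ 9 * s ^ 2 := by
  classical
  haveI : NeZero m := ⟨by omega⟩
  have hs1 : 1 ≤ s := by
    refine le_trans ?_ (hs (Sum.inr 0))
    rw [Nat.one_le_iff_ne_zero, Ne, Set.ncard_eq_zero (Set.toFinite _)]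
    exact Set.Nonempty.ne_empty ⟨Sum.inr 0, SimpleGraph.Reachable.refl _⟩
  by_cases hsm : m ≤ s
  · nlinarith
  push Not at hsm
  let A : Fin 2 → Finset (ZMod m) := fun k =>
    Finset.univ.filter (fun i => col (Sum.inl i) = col (Sum.inr k))
  have hA : ∀ k, (A k).card ≤ s := by
    intro k
    refine le_trans ?_ (hs (Sum.inr k))
    rw [← Set.ncard_coe_finset, ← Set.ncard_image_of_injective _ (Sum.inl_injective (β := Fin 2))]
    refine Set.ncard_le_ncard ?_ (Set.toFinite _)
    rintro _ ⟨i, hi, rfl⟩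
    exact (mono_hub_adj col i k (by simpa [A] using hi)).reachable
  have hcov : (Finset.univ : Finset (ZMod m)) ⊆
      Finset.image (fun p : ZMod m × ℕ => p.1 + p.2) ((A 0 ∪ A 1) ×ˢ Finset.range (s + 1)) := by
    intro i _
    by_contra hi
    have hno : ∀ d : ℕ, d < s + 1 → col (Sum.inl (i - d)) ≠ col (Sum.inr 0) ∧
        col (Sum.inl (i - d)) ≠ col (Sum.inr 1) := by
      intro d hd
      by_contra hcon
      apply hi
      rw [Finset.mem_image]
      refine ⟨(i - d, d), ?_, by simp⟩
      simp only [Finset.mem_product, Finset.mem_union, Finset.mem_range, A, Finset.mem_filter,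
        Finset.mem_univ, true_and]
      exact ⟨by tauto, hd⟩
    have hreach : ∀ d : ℕ, d < s + 1 →
        (monoSubgraph (doubleWheelGraph m) col).Reachable (Sum.inl i) (Sum.inl (i - d)) := by
      intro d
      induction d with
      | zero => intro _; simp
      | succ d ih =>
        intro hd
        refine (ih (by omega)).trans (mono_rim_adj hm col _ _ (by push_cast; ring) ?_).reachable
        have h1 := hno d (by omega)
        have h2 := hno (d + 1) hd
        generalize col (Sum.inl (i - (d : ℕ))) = x at *
        generalize col (Sum.inl (i - ((d + 1 : ℕ) : ZMod m))) = y at *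
        generalize col (Sum.inr 0) = a at *
        generalize col (Sum.inr 1) = b at *
        omega
    have hinj : Set.InjOn (fun d : ℕ => (Sum.inl (i - (d : ZMod m)) : ZMod m ⊕ Fin 2))
        (Finset.range (s + 1) : Finset ℕ) := by
      intro a ha b hb hab
      simp only [Finset.coe_range, Set.mem_Iio] at ha hb
      have h : (a : ZMod m) = b := by simpa using hab
      rw [ZMod.natCast_eq_natCast_iff'] at h
      rwa [Nat.mod_eq_of_lt (by omega), Nat.mod_eq_of_lt (by omega)] at h
    have hle := hs (Sum.inl i)
    have h2 : s + 1 ≤ (monoComponent (doubleWheelGraph m) col (Sum.inl i)).ncard := by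
      calc s + 1 = ((Finset.range (s + 1) : Finset ℕ) : Set ℕ).ncard := by
            rw [Set.ncard_coe_finset, Finset.card_range]
        _ = _ := (Set.ncard_image_of_injOn hinj).symm
        _ ≤ _ := by
            refine Set.ncard_le_ncard ?_ (Set.toFinite _)
            rintro _ ⟨d, hd, rfl⟩
            exact hreach d (by simpa using hd)
    omega
  have hcard := (Finset.card_le_card hcov).trans Finset.card_image_le
  rw [Finset.card_product, Finset.card_range, Finset.card_univ, ZMod.card] at hcard
  have hu : (A 0 ∪ A 1).card ≤ 2 * s := by
    have := Finset.card_union_le (A 0) (A 1)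
    have := hA 0
    have := hA 1
    omega
  have := Nat.mul_le_mul_right (s + 1) hu
  nlinarith

/-- There is a constant `c > 0` such that for every `n ≥ 5` and every 3-coloring of the
double wheel on `n` vertices in which the two central vertices get different colors,
some monochromatic connected component has at least `c * √n` vertices. -/
theorem doubleWheel_mcc3_lower_of_centers_differ :
    ∃ c : ℝ, 0 < c ∧ ∀ n : ℕ, 5 ≤ n →
      ∀ col : (ZMod (n - 2) ⊕ Fin 2) → Fin 3,
        col (Sum.inr 0) ≠ col (Sum.inr 1) →
        ∃ v : ZMod (n - 2) ⊕ Fin 2,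
          c * Real.sqrt n ≤ ((monoComponent (doubleWheelGraph (n - 2)) col v).ncard : ℝ) := by
  refine ⟨1 / 3, by norm_num, ?_⟩
  intro n hn col hc
  haveI : NeZero (n - 2) := ⟨by omega⟩
  obtain ⟨v, hv⟩ := Finite.exists_max
    (fun v => (monoComponent (doubleWheelGraph (n - 2)) col v).ncard)
  refine ⟨v, ?_⟩
  have h := dw_aux (by omega) col hc _ hv
  rw [Nat.sub_add_cancel (by omega)] at h
  have h' : (n : ℝ) ≤ (3 * ((monoComponent (doubleWheelGraph (n - 2)) col v).ncard : ℝ)) ^ 2 := by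
    have : (n : ℝ) ≤ 9 * ((monoComponent (doubleWheelGraph (n - 2)) col v).ncard : ℝ) ^ 2 := by
      exact_mod_cast h
    linarith [mul_pow (3 : ℝ) ((monoComponent (doubleWheelGraph (n - 2)) col v).ncard : ℝ) 2]
  have := Real.sqrt_le_iff.mpr ⟨by positivity, h'⟩
  linarith
end

section
/- There exists a constant C > 0 such that every outerpath O with maximum degree Δ satisfies mcc_2(O) ≤ C·√Δ; that is, the vertices of O can be 2-colored so that every monochromatic connected component has at most C·√Δ vertices. -/
/-- `G` is an outerpath: a biconnected maximal outerplanar graph whose weak dual is a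
path.  Equivalently, writing `n = |V| ≥ 3`, the vertices can be enumerated
`x 0, x 1, …, x (n-1)` so that the internal triangles are `t i = {a i, b i, x (i+2)}`
for `0 ≤ i ≤ n - 3`, where the edge shared by consecutive triangles `t i` and `t (i+1)`
is `{a (i+1), b (i+1)}` with `b (i+1) = x (i+2)` (the vertex of `t i` that is new) and
`a (i+1)` one of the two remaining vertices of `t i`; the first triangle is stacked on
the edge `{x 0, x 1}`, and the edges of `G` are exactly the edges of these triangles. -/
def IsOuterpath {V : Type} [Fintype V] (G : SimpleGraph V) : Prop :=
  3 ≤ Fintype.card V ∧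
  ∃ x a b : ℕ → V,
    Set.InjOn x (Set.Iio (Fintype.card V)) ∧
    (∀ v : V, ∃ i < Fintype.card V, x i = v) ∧
    a 0 = x 0 ∧ b 0 = x 1 ∧
    (∀ i : ℕ, i + 4 ≤ Fintype.card V →
      (a (i + 1) = a i ∨ a (i + 1) = b i) ∧ b (i + 1) = x (i + 2)) ∧
    (∀ u v : V, G.Adj u v ↔ u ≠ v ∧ ∃ i : ℕ, i + 3 ≤ Fintype.card V ∧
      u ∈ ({a i, b i, x (i + 2)} : Set V) ∧ v ∈ ({a i, b i, x (i + 2)} : Set V))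

/-- State: (hub colour, first hub position of the group, label of the group). -/
def opState (h : ℕ → ℕ) (s : ℕ) : ℕ → Bool × ℕ × ℕ
  | 0 => (true, 0, 0)
  | i + 1 =>
    if h (i + 1) = h i ∨ (opState h s i).2.1 = i then opState h s i
    else (!(opState h s i).1, i + 1,
      if (i - h i) % s ≤ 1 then i + 1 else i - (i - h i) % s + 2)

def opCol (h : ℕ → ℕ) (s j : ℕ) : Bool :=
  if (j - h j) % s ≤ 1 then (opState h s j).1 else !(opState h s j).1

def opLab (h : ℕ → ℕ) (s j : ℕ) : ℕ :=
  if (j - h j) % s ≤ 1 then (opState h s j).2.2 else j - (j - h j) % s + 2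

section
variable {h : ℕ → ℕ} {s : ℕ}

theorem op_h_le (h0 : h 0 = 0) (hs : ∀ i, h (i + 1) = h i ∨ h (i + 1) = i + 1) (i : ℕ) :
    h i ≤ i := by
  induction i with
  | zero => omega
  | succ i ih => rcases hs i with e | e <;> omega

theorem op_inv (h0 : h 0 = 0) (hs : ∀ i, h (i + 1) = h i ∨ h (i + 1) = i + 1) (i : ℕ) :
    (opState h s i).2.1 ≤ h i ∧ h i ≤ (opState h s i).2.1 + 1 ∧
      (opState h s i).2.2 ≤ (opState h s i).2.1 := by
  induction i with
  | zero => simp [opState, h0]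
  | succ i ih =>
    have hl := op_h_le h0 hs i
    rw [opState]
    split_ifs with h1 h2
    · rcases h1 with h1 | h1
      · rw [h1]; exact ih
      · rcases hs i with e | e <;> omega
    · rcases hs i with e | e
      · exact absurd (Or.inl e) h1
      · simp [e]
    · rcases hs i with e | e
      · exact absurd (Or.inl e) h1
      · simp only [e]; omega

theorem op_hub (h0 : h 0 = 0) (hs : ∀ i, h (i + 1) = h i ∨ h (i + 1) = i + 1) (i : ℕ) :
    h (h i) = h i ∧ opState h s (h i) = opState h s i := by
  induction i with
  | zero => simp [h0]
  | succ i ih =>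
    rcases hs i with e | e
    · rw [e]
      refine ⟨ih.1, ih.2.trans ?_⟩
      rw [opState, if_pos (Or.inl e)]
    · rw [e]; exact ⟨e, rfl⟩

theorem op_mono (h0 : h 0 = 0) (hs : ∀ i, h (i + 1) = h i ∨ h (i + 1) = i + 1) (i d : ℕ) :
    ((opState h s (i + d)).2.1 = (opState h s i).2.1 ∧
      (opState h s (i + d)).2.2 = (opState h s i).2.2) ∨
      (opState h s i).2.2 < (opState h s (i + d)).2.2 := by
  induction d with
  | zero => simp
  | succ d ih =>
    have hl := op_h_le h0 hs (i + d)
    have hi := op_inv (s := s) h0 hs (i + d)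
    have hm := Nat.mod_le (i + d - h (i + d)) s
    rw [← Nat.add_assoc, opState]
    split_ifs with h1 h2
    · exact ih
    · right; simp only; omega
    · right; simp only; omega

theorem op_F_of_G (h0 : h 0 = 0) (hs : ∀ i, h (i + 1) = h i ∨ h (i + 1) = i + 1) (i j : ℕ)
    (e : (opState h s i).2.2 = (opState h s j).2.2) :
    (opState h s i).2.1 = (opState h s j).2.1 := by
  rcases le_total i j with hij | hij
  · obtain ⟨d, rfl⟩ := Nat.exists_eq_add_of_le hij
    rcases op_mono (s := s) h0 hs i d with h1 | h1 <;> omega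
  · obtain ⟨d, rfl⟩ := Nat.exists_eq_add_of_le hij
    rcases op_mono (s := s) h0 hs j d with h1 | h1 <;> omega

theorem op_st_same {i : ℕ} (e : h (i + 1) = h i) : opState h s (i + 1) = opState h s i := by
  rw [opState, if_pos (Or.inl e)]

theorem op_st_merge {i : ℕ} (e : (opState h s i).2.1 = i) :
    opState h s (i + 1) = opState h s i := by
  rw [opState, if_pos (Or.inr e)]

theorem op_st_fresh {i : ℕ} (e : h (i + 1) ≠ h i) (e' : (opState h s i).2.1 ≠ i) :
    opState h s (i + 1) = (!(opState h s i).1, i + 1,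
      if (i - h i) % s ≤ 1 then i + 1 else i - (i - h i) % s + 2) := by
  rw [opState, if_neg (by tauto)]

theorem op_hubpos {j : ℕ} (e : h j = j) :
    opCol h s j = (opState h s j).1 ∧ opLab h s j = (opState h s j).2.2 := by
  simp [opCol, opLab, e]

theorem op_seppos {j : ℕ} (e : (j - h j) % s ≤ 1) :
    opCol h s j = (opState h s j).1 ∧ opLab h s j = (opState h s j).2.2 := by
  simp [opCol, opLab, e]

theorem op_edge1 (h0 : h 0 = 0) (hs : ∀ i, h (i + 1) = h i ∨ h (i + 1) = i + 1) (hs1 : 1 ≤ s)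
    (j : ℕ) (hc : opCol h s j = opCol h s (j + 1)) : opLab h s j = opLab h s (j + 1) := by
  have hl := op_h_le h0 hs j
  have hi := op_inv (s := s) h0 hs j
  rcases hs j with e | e
  · have st := op_st_same (s := s) e
    unfold opCol at hc
    unfold opLab
    rw [st, e] at hc ⊢
    by_cases h1 : (j - h j) % s ≤ 1 <;> by_cases h2 : (j + 1 - h j) % s ≤ 1
    · simp [h1, h2]
    · simp [h1, h2] at hc
    · simp [h1, h2] at hc
    · simp only [h1, h2, if_false]
      have : (j + 1 - h j) % s = (j - h j) % s + 1 := by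
        have e1 : j + 1 - h j = (j - h j) + 1 := by omega
        rw [e1] at h2 ⊢
        rw [Nat.add_mod_eq_ite] at h2 ⊢
        have hlt := Nat.mod_lt (j - h j) hs1
        have h1s : 1 % s = 1 := Nat.mod_eq_of_lt (by omega)
        rw [h1s] at h2 ⊢
        split_ifs at h2 ⊢ with h3
        · omega
        · rfl
      have := Nat.mod_le (j - h j) s
      have := Nat.mod_le (j + 1 - h j) s
      omega
  · have hp := op_hubpos (s := s) e
    rw [hp.2]
    rw [hp.1] at hc
    by_cases hF : (opState h s j).2.1 = j
    · rw [op_st_merge hF]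
      exact (op_hubpos (by omega)).2
    · have st := op_st_fresh (s := s) (by omega) hF
      rw [st] at hc ⊢
      unfold opCol at hc
      unfold opLab
      by_cases h1 : (j - h j) % s ≤ 1
      · simp [h1] at hc
      · simp [h1]

theorem op_edge2 (h0 : h 0 = 0) (hs : ∀ i, h (i + 1) = h i ∨ h (i + 1) = i + 1)
    (i : ℕ) (hc : opCol h s (h i) = opCol h s (i + 1)) :
    opLab h s (h i) = opLab h s (i + 1) := by
  have hl := op_h_le h0 hs i
  have hh := op_hub (s := s) h0 hs i
  have hp := op_hubpos (s := s) hh.1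
  rw [hh.2] at hp
  rw [hp.2]
  rw [hp.1] at hc
  rcases hs i with e | e
  · have st := op_st_same (s := s) e
    unfold opCol at hc
    unfold opLab
    rw [st] at hc ⊢
    by_cases h2 : (i + 1 - h (i + 1)) % s ≤ 1
    · simp [h2]
    · simp [h2] at hc
  · have hq := op_hubpos (s := s) e
    rw [hq.1] at hc
    rw [hq.2]
    by_cases hF : (opState h s i).2.1 = i
    · rw [op_st_merge hF]
    · rw [op_st_fresh (by omega) hF] at hc
      simp at hc

theorem op_edge3 (h0 : h 0 = 0) (hs : ∀ i, h (i + 1) = h i ∨ h (i + 1) = i + 1)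
    (i : ℕ) (hc : opCol h s (h i) = opCol h s (i + 2)) :
    opLab h s (h i) = opLab h s (i + 2) := by
  have hl := op_h_le h0 hs i
  rcases hs i with e | e
  · rw [← e] at hc ⊢
    exact op_edge2 h0 hs (i + 1) hc
  have hh := op_hub (s := s) h0 hs i
  have hp := op_hubpos (s := s) hh.1
  rw [hh.2] at hp
  rw [hp.2]
  rw [hp.1] at hc
  have hsep : opCol h s (i + 2) = (opState h s (i + 2)).1 ∧
      opLab h s (i + 2) = (opState h s (i + 2)).2.2 := by
    apply op_seppos
    rcases hs (i + 1) with e2 | e2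
    · rw [e2, e]
      have : i + 2 - (i + 1) = 1 := by omega
      rw [this]; exact Nat.mod_le 1 s
    · simp [e2]
  rw [hsep.1] at hc
  rw [hsep.2]
  by_cases hF : (opState h s i).2.1 = i
  · have st := op_st_merge hF
    rcases hs (i + 1) with e2 | e2
    · rw [op_st_same (i := i + 1) e2, st]
    · rw [op_st_fresh (i := i + 1) (by omega) (by rw [st]; omega), st] at hc
      simp at hc
  · have st := op_st_fresh (s := s) (by omega) hF
    have : opState h s (i + 2) = opState h s (i + 1) := by
      apply op_st_merge (i := i + 1)
      rw [st]
    rw [this, st] at hc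
    simp at hc

theorem op_fiber (h0 : h 0 = 0) (hs : ∀ i, h (i + 1) = h i ∨ h (i + 1) = i + 1) (hs1 : 1 ≤ s)
    (n D : ℕ) (hD : ∀ j < n, j - h j ≤ D) (L : ℕ) :
    ∃ T : Finset ℕ, T.card ≤ s + (D / s + 1) * 3 ∧ ∀ j < n, opLab h s j = L → j ∈ T := by
  obtain ⟨P, hP⟩ : ∃ P, ∀ j, (opState h s j).2.2 = L → (opState h s j).2.1 = P := by
    by_cases hex : ∃ j, (opState h s j).2.2 = L
    · obtain ⟨j, hj⟩ := hex
      exact ⟨_, fun k hk => op_F_of_G h0 hs k j (hk.trans hj.symm)⟩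
    · exact ⟨0, fun k hk => absurd ⟨k, hk⟩ hex⟩
  refine ⟨Finset.Ico L (L + s) ∪ ((Finset.range (D / s + 1) ×ˢ Finset.range 3).image
    fun p => P + s * p.1 + p.2), ?_, ?_⟩
  · refine (Finset.card_union_le _ _).trans ?_
    refine add_le_add (by simp) (Finset.card_image_le.trans (by simp))
  · intro j hj hL
    have hl := op_h_le h0 hs j
    have hm := Nat.mod_le (j - h j) s
    have hlt := Nat.mod_lt (j - h j) hs1
    unfold opLab at hL
    split_ifs at hL with h1
    · have hF := hP j hL
      have hi := op_inv (s := s) h0 hs j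
      refine Finset.mem_union_right _ (Finset.mem_image.2
        ⟨((j - h j) / s, (j - h j) % s + (h j - P)), ?_, ?_⟩)
      · rw [Finset.mem_product, Finset.mem_range, Finset.mem_range]
        refine ⟨Nat.lt_succ_of_le (Nat.div_le_div_right (hD j hj)), ?_⟩
        simp only; omega
      · have := Nat.mod_add_div (j - h j) s
        simp only; omega
    · refine Finset.mem_union_left _ (Finset.mem_Ico.2 ?_)
      omega

end

noncomputable def opHub {V : Type} (a : ℕ → V) (n : ℕ) : ℕ → ℕ
  | 0 => 0
  | i + 1 => open Classical in if i + 4 ≤ n ∧ a (i + 1) ≠ a i then i + 1 else opHub a n i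

/-- There is a constant `C > 0` such that every outerpath with maximum degree `Δ` can be
2-colored so that every monochromatic connected component has at most `C * √Δ`
vertices. -/
theorem outerpath_mcc2_upper :
    ∃ C : ℝ, 0 < C ∧
      ∀ (V : Type) [Fintype V] (G : SimpleGraph V) [DecidableRel G.Adj],
        IsOuterpath G →
        ∃ col : V → Fin 2,
          ∀ v : V, ((monoComponent G col v).ncard : ℝ) ≤ C * Real.sqrt G.maxDegree := by
  refine ⟨14, by norm_num, ?_⟩
  intro V _ G _ hG
  classical
  obtain ⟨hn, x, a, b, xinj, xsurj, ha0, hb0, hstep, hadj⟩ := hG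
  generalize hnn : Fintype.card V = n at *
  obtain ⟨h, hh⟩ : ∃ h, h = opHub a n := ⟨_, rfl⟩
  have h0 : h 0 = 0 := by rw [hh]; rfl
  have hs : ∀ i, h (i + 1) = h i ∨ h (i + 1) = i + 1 := by
    intro i
    rw [hh, opHub]
    split_ifs
    · right; rfl
    · left; rfl
  have hle := op_h_le h0 hs
  have hb : ∀ i, i + 3 ≤ n → b i = x (i + 1) := by
    intro i hi
    cases i with
    | zero => exact hb0
    | succ i => exact (hstep i (by omega)).2
  have ha : ∀ i, i + 3 ≤ n → a i = x (h i) := by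
    intro i
    induction i with
    | zero => intro _; rw [h0, ha0]
    | succ i ih =>
      intro hi
      by_cases e : a (i + 1) = a i
      · have : h (i + 1) = h i := by
          rw [hh, opHub, if_neg (by tauto)]
        rw [this, e]; exact ih (by omega)
      · have : h (i + 1) = i + 1 := by
          rw [hh, opHub, if_pos ⟨by omega, e⟩]
        rw [this, ← hb i (by omega)]
        exact ((hstep i (by omega)).1).resolve_left e
  have hxne : ∀ i j, i < n → j < n → i ≠ j → x i ≠ x j :=
    fun i j hi hj hne he => hne (xinj hi hj he)
  -- degree bound
  have hdeg : ∀ j, j + 3 ≤ n → j + 1 - h j ≤ G.maxDegree := by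
    intro j hj
    have hconst : ∀ d, h j + d ≤ j → h (h j + d) = h j := by
      intro d
      induction d with
      | zero => intro _; exact (op_hub (s := 1) h0 hs j).1
      | succ d ih =>
        intro hd
        rcases hs (h j + d) with e | e
        · rw [← Nat.add_assoc, e]; exact ih (by omega)
        · exfalso
          have hmono : Monotone h := by
            apply monotone_nat_of_le_succ
            intro i
            have := hle i
            rcases hs i with e | e <;> omega
          have := hmono hd
          rw [← Nat.add_assoc, e] at this
          omega
    have hsub : (Finset.Ico (h j + 1) (j + 2)).image x ⊆ G.neighborFinset (x (h j)) := by
      intro v hv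
      obtain ⟨q, hq, rfl⟩ := Finset.mem_image.1 hv
      rw [Finset.mem_Ico] at hq
      rw [SimpleGraph.mem_neighborFinset, hadj]
      have := hle j
      refine ⟨hxne _ _ (by omega) (by omega) (by omega), q - 1, by omega, ?_, ?_⟩
      · left
        rw [ha (q - 1) (by omega)]
        have := hconst (q - 1 - h j) (by omega)
        rw [show h j + (q - 1 - h j) = q - 1 by omega] at this
        rw [this]
      · right; left
        rw [hb (q - 1) (by omega), show q - 1 + 1 = q by omega]
    have hcard := Finset.card_le_card hsub
    rw [Finset.card_image_of_injOn, Nat.card_Ico, SimpleGraph.card_neighborFinset_eq_degree]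
      at hcard
    · have := G.degree_le_maxDegree (x (h j))
      omega
    · intro p hp q hq e
      simp only [Finset.coe_Ico, Set.mem_Ico] at hp hq
      exact xinj (show p < n by omega) (show q < n by omega) e
  have hD : ∀ j < n, j - h j ≤ G.maxDegree + 1 := by
    intro j hj
    have hm : ∀ i, h i ≤ h (i + 1) := by
      intro i
      have := hle i
      rcases hs i with e | e <;> omega
    by_cases h1 : j + 3 ≤ n
    · have := hdeg j h1; omega
    · have h2 := hdeg (n - 3) (by omega)
      have h3 := hm (n - 3)
      have h4 := hm (n - 3 + 1)
      have h5 : j = n - 3 + 1 ∨ j = n - 3 + 1 + 1 := by omega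
      rcases h5 with rfl | rfl <;> omega
  have hΔ : 1 ≤ G.maxDegree := by
    have := hdeg 0 hn
    omega
  obtain ⟨s, hsdef⟩ : ∃ s, s = Nat.sqrt G.maxDegree + 1 := ⟨_, rfl⟩
  have hs1 : 1 ≤ s := by omega
  choose idx hidx1 hidx2 using xsurj
  have hidx : ∀ i < n, idx (x i) = i := fun i hi => xinj (hidx1 _) hi (hidx2 _)
  have hedge : ∀ u v, G.Adj u v → opCol h s (idx u) = opCol h s (idx v) →
      opLab h s (idx u) = opLab h s (idx v) := by
    intro u v huv hc
    obtain ⟨-, i, hi, hu, hv⟩ := (hadj u v).1 huv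
    rw [ha i hi, hb i hi] at hu hv
    have i1 := hidx (h i) (by have := hle i; omega)
    have i2 := hidx (i + 1) (by omega)
    have i3 := hidx (i + 2) (by omega)
    simp only [Set.mem_insert_iff, Set.mem_singleton_iff] at hu hv
    have e1 := op_edge1 h0 hs hs1 (i + 1)
    have e2 := op_edge2 (s := s) h0 hs i
    have e3 := op_edge3 (s := s) h0 hs i
    rcases hu with rfl | rfl | rfl <;> rcases hv with rfl | rfl | rfl <;>
      simp only [i1, i2, i3] at hc ⊢
    · exact e2 hc
    · exact e3 hc
    · exact (e2 hc.symm).symm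
    · exact e1 hc
    · exact (e3 hc.symm).symm
    · exact (e1 hc.symm).symm
  refine ⟨fun v => if opCol h s (idx v) then 1 else 0, ?_⟩
  intro v
  have hreach : ∀ u ∈ monoComponent G (fun v => if opCol h s (idx v) then (1 : Fin 2) else 0) v,
      opLab h s (idx u) = opLab h s (idx v) := by
    intro u hu
    obtain ⟨w⟩ := hu
    induction w with
    | nil => rfl
    | cons hadj' _ ih =>
      rw [ih]
      have hcc : ∀ p q : Bool, (if p then (1 : Fin 2) else 0) = (if q then 1 else 0) → p = q := by
        decide
      unfold monoSubgraph at hadj'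
      rw [SimpleGraph.fromRel_adj] at hadj'
      rcases hadj'.2 with ⟨h1, h2⟩ | ⟨h1, h2⟩
      · exact (hedge _ _ h1 (hcc _ _ h2)).symm
      · exact hedge _ _ h1 (hcc _ _ h2)
  obtain ⟨T, hT, hT2⟩ := op_fiber h0 hs hs1 n _ hD (opLab h s (idx v))
  have hcard : (monoComponent G (fun v => if opCol h s (idx v) then (1 : Fin 2) else 0) v).ncard
      ≤ T.card := by
    rw [← Set.ncard_coe_finset T]
    apply Set.ncard_le_ncard_of_injOn idx
    · intro u hu
      exact hT2 _ (hidx1 u) (hreach u hu)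
    · intro p _ q _ e
      rw [← hidx2 p, ← hidx2 q, e]
  have hdiv : (G.maxDegree + 1) / s ≤ s := by
    apply Nat.div_le_of_le_mul
    have := Nat.lt_succ_sqrt G.maxDegree
    rw [hsdef]; exact this
  have hfin : (monoComponent G (fun v => if opCol h s (idx v) then (1 : Fin 2) else 0) v).ncard
      ≤ 14 * Nat.sqrt G.maxDegree := by
    have : 1 ≤ Nat.sqrt G.maxDegree := Nat.sqrt_pos.2 hΔ
    omega
  calc _ ≤ ((14 * Nat.sqrt G.maxDegree : ℕ) : ℝ) := by exact_mod_cast hfin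
    _ ≤ _ := by
      push_cast
      exact mul_le_mul_of_nonneg_left (Real.nat_sqrt_le_real_sqrt) (by norm_num)
end

section
/- There exists a constant c > 0 such that every outerpath O with maximum degree Δ ≥ 4 satisfies mcc_2(O) ≥ c·√Δ; that is, in every 2-coloring of the vertices of O some monochromatic connected component has at least c·√Δ vertices. -/
lemma op_down {V : Type} {n : ℕ} {x a b : ℕ → V} (hx : Set.InjOn x (Set.Iio n))
    (hb : ∀ i, i + 3 ≤ n → b i = x (i + 1))
    (hs : ∀ i : ℕ, i + 4 ≤ n → (a (i + 1) = a i ∨ a (i + 1) = b i) ∧ b (i + 1) = x (i + 2))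
    {k i' : ℕ} (d : ℕ) : i' + d + 3 ≤ n → a (i' + d) = x k → k ≤ i' → a i' = x k := by
  induction d with
  | zero => intro _ h _; exact h
  | succ d ih =>
    intro h1 h2 h3
    refine ih (by omega) ?_ h3
    rcases (hs (i' + d) (by omega)).1 with h | h
    · rw [← h]; exact h2
    · exfalso
      rw [hb _ (by omega)] at h
      have : x k = x (i' + d + 1) := by rw [← h]; exact h2.symm
      have := hx (by simp; omega) (by simp; omega) this
      omega

lemma op_struct {V : Type} [Fintype V] (G : SimpleGraph V) [DecidableRel G.Adj]
    (h : IsOuterpath G) : ∃ (x : ℕ → V) (k : ℕ), k < Fintype.card V ∧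
      Set.InjOn x (Set.Iio (Fintype.card V)) ∧
      (∀ j, j + 1 < Fintype.card V → G.Adj (x j) (x (j + 1))) ∧
      ∀ j, 1 ≤ j → j + 2 ≤ G.maxDegree → k + j < Fintype.card V ∧ G.Adj (x k) (x (k + j)) := by
  classical
  obtain ⟨hn, x, a, b, hx, hsurj, ha0, hb0, hs, hadj⟩ := h
  generalize hN : Fintype.card V = n at *
  have hne : Nonempty V := ⟨x 0⟩
  have hinj : ∀ i j, i < n → j < n → x i = x j → i = j := fun i j hi hj e => hx hi hj e
  have hb : ∀ i, i + 3 ≤ n → b i = x (i + 1) := by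
    intro i hi
    cases i with
    | zero => exact hb0
    | succ i => exact (hs i (by omega)).2
  have ha : ∀ i, i + 3 ≤ n → ∃ p ≤ i, a i = x p := by
    intro i
    induction i with
    | zero => intro _; exact ⟨0, le_rfl, ha0⟩
    | succ i ih =>
      intro hi
      rcases (hs i (by omega)).1 with h | h
      · obtain ⟨p, hp, e⟩ := ih (by omega)
        exact ⟨p, by omega, h.trans e⟩
      · exact ⟨i + 1, le_rfl, h.trans (hb i (by omega))⟩
  -- index form of adjacency
  have key : ∀ k j, k < j → j < n → G.Adj (x k) (x j) →
      (j = k + 1 ∨ ∃ i, i + 3 ≤ n ∧ a i = x k ∧ k ≤ i ∧ (j = i + 1 ∨ j = i + 2)) := by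
    intro k j hkj hj h
    obtain ⟨-, i, hi, hu, hv⟩ := (hadj _ _).1 h
    obtain ⟨p, hp, e⟩ := ha i hi
    rw [hb i hi, e] at hu hv
    simp only [Set.mem_insert_iff, Set.mem_singleton_iff] at hu hv
    have hu' : k = p ∨ k = i + 1 ∨ k = i + 2 := by
      rcases hu with h | h | h
      · left; exact hinj _ _ (by omega) (by omega) h
      · right; left; exact hinj _ _ (by omega) (by omega) h
      · right; right; exact hinj _ _ (by omega) (by omega) h
    have hv' : j = p ∨ j = i + 1 ∨ j = i + 2 := by
      rcases hv with h | h | h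
      · left; exact hinj _ _ (by omega) (by omega) h
      · right; left; exact hinj _ _ (by omega) (by omega) h
      · right; right; exact hinj _ _ (by omega) (by omega) h
    by_cases hk : k = p
    · subst hk
      right; exact ⟨i, hi, e, hp, by omega⟩
    · left; omega
  have hpath : ∀ j, j + 1 < n → G.Adj (x j) (x (j + 1)) := by
    intro j hj
    refine (hadj _ _).2 ⟨fun e => ?_, ?_⟩
    · have := hinj _ _ (by omega) (by omega) e; omega
    · cases j with
      | zero => exact ⟨0, by omega, by simp [ha0], by simp [hb0]⟩
      | succ j => exact ⟨j, by omega, by simp [hb j (by omega)], by simp⟩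
  have hclosed : ∀ k j j', k < j' → j' ≤ j → j < n → G.Adj (x k) (x j) → G.Adj (x k) (x j') := by
    intro k j j' h1 h2 h3 h4
    rcases key k j (by omega) h3 h4 with h | ⟨i, hi, hai, hki, hji⟩
    · obtain rfl : j' = k + 1 := by omega
      exact hpath _ (by omega)
    · by_cases hj' : j' = k + 1
      · subst hj'; exact hpath _ (by omega)
      have hd : a (j' - 2) = x k := by
        refine op_down hx hb hs (i - (j' - 2)) (by omega) ?_ (by omega)
        rw [show j' - 2 + (i - (j' - 2)) = i by omega]; exact hai
      refine (hadj _ _).2 ⟨fun e => ?_, j' - 2, by omega, by simp [hd], ?_⟩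
      · have := hinj _ _ (by omega) (by omega) e; omega
      · rw [show j' - 2 + 2 = j' by omega]; simp
  obtain ⟨v, hv⟩ := G.exists_maximal_degree_vertex
  obtain ⟨k, hk, rfl⟩ := hsurj v
  refine ⟨x, k, hk, hx, hpath, ?_⟩
  intro j hj1 hj2
  by_contra hcon
  have hsub : G.neighborFinset (x k) ⊆
      (Finset.Ico (k + 1) (k + j)).image x ∪ {a (k - 2), x (k - 1)} := by
    intro w hw
    rw [SimpleGraph.mem_neighborFinset] at hw
    obtain ⟨l, hl, rfl⟩ := hsurj w
    simp only [Finset.mem_union, Finset.mem_image, Finset.mem_Ico, Finset.mem_insert,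
      Finset.mem_singleton]
    rcases lt_trichotomy l k with hlt | heq | hgt
    · right
      rcases key l k hlt hk hw.symm with h | ⟨i, hi, hai, hki, hji⟩
      · right; rw [h]; simp
      · by_cases hlk : l = k - 1
        · right; rw [hlk]
        left
        refine (op_down hx hb hs (i - (k - 2)) (by omega) ?_ (by omega)).symm
        rw [show k - 2 + (i - (k - 2)) = i by omega]; exact hai
    · subst heq; exact absurd hw (G.loopless.irrefl _)
    · left
      refine ⟨l, ⟨by omega, ?_⟩, rfl⟩
      by_contra hge
      exact hcon ⟨by omega, hclosed k l (k + j) (by omega) (by omega) hl hw⟩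
  have h1 := Finset.card_le_card hsub
  have h2 := Finset.card_union_le ((Finset.Ico (k + 1) (k + j)).image x) {a (k - 2), x (k - 1)}
  have h3 : ((Finset.Ico (k + 1) (k + j)).image x).card ≤ k + j - (k + 1) :=
    Finset.card_image_le.trans (by simp)
  have h4 : ({a (k - 2), x (k - 1)} : Finset V).card ≤ 2 := Finset.card_le_two
  rw [SimpleGraph.card_neighborFinset_eq_degree] at h1
  omega

lemma op_mono_adj {V α : Type} (G : SimpleGraph V) (c : V → α) {u v : V} (h : G.Adj u v)
    (hc : c u = c v) : (monoSubgraph G c).Adj u v := by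
  rw [monoSubgraph, SimpleGraph.fromRel_adj]
  exact ⟨h.ne, Or.inl ⟨h, hc⟩⟩

lemma op_bound {V : Type} [Fintype V] (G : SimpleGraph V) [DecidableRel G.Adj]
    (h : IsOuterpath G) (col : V → Fin 2) (m : ℕ)
    (hm : ∀ v, (monoComponent G col v).ncard ≤ m) : G.maxDegree < m * (m + 1) + 2 := by
  classical
  obtain ⟨x, k, hk, hx, hpath, hfan⟩ := op_struct G h
  by_contra hcon
  push Not at hcon
  have hle : ∀ i < m, ∀ t ≤ m, i * (m + 1) + 1 + t + 2 ≤ G.maxDegree := by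
    intro i hi t ht
    have : (i + 1) * (m + 1) ≤ m * (m + 1) := Nat.mul_le_mul_right _ hi
    nlinarith
  have hblock : ∀ i < m, ∃ t ≤ m, col (x (k + (i * (m + 1) + 1 + t))) = col (x k) := by
    intro i hi
    by_contra hno
    push Not at hno
    set s := k + (i * (m + 1) + 1) with hs
    have hlt : ∀ t ≤ m, s + t < Fintype.card V := fun t ht => by
      have := (hfan _ (by omega) (hle i hi t ht)).1
      omega
    have hno' : ∀ t ≤ m, col (x (s + t)) ≠ col (x k) := fun t ht => by
      have := hno t ht
      rwa [show k + (i * (m + 1) + 1 + t) = s + t by omega] at this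
    have hreach : ∀ t ≤ m, (monoSubgraph G col).Reachable (x s) (x (s + t)) := by
      intro t
      induction t with
      | zero => intro _; exact SimpleGraph.Reachable.refl _
      | succ t ih =>
        intro ht
        refine (ih (by omega)).trans (SimpleGraph.Adj.reachable ?_)
        refine op_mono_adj G col (hpath (s + t) (hlt (t + 1) ht)) ?_
        have e1 := hno' t (by omega)
        have e2 := hno' (t + 1) ht
        rw [show s + (t + 1) = s + t + 1 by omega] at e2
        generalize col (x (s + t)) = p at *
        generalize col (x (s + t + 1)) = q at *
        generalize col (x k) = r at *
        omega
    have hsub : (((Finset.range (m + 1)).image fun t => x (s + t) : Finset V) : Set V) ⊆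
        monoComponent G col (x s) := by
      intro w hw
      simp only [Finset.coe_image, Set.mem_image, Finset.mem_coe, Finset.mem_range] at hw
      obtain ⟨t, ht, rfl⟩ := hw
      exact hreach t (by omega)
    have h1 := Set.ncard_le_ncard hsub (Set.toFinite _)
    rw [Set.ncard_coe_finset, Finset.card_image_of_injOn, Finset.card_range] at h1
    · have := hm (x s); omega
    · intro t ht t' ht' e
      simp only [Finset.coe_range, Set.mem_Iio] at ht ht'
      have := hx (hlt t (by omega)) (hlt t' (by omega)) e
      omega
  choose! f hf1 hf2 using hblock
  let g : ℕ → ℕ := fun i => k + (i * (m + 1) + 1 + f i)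
  have hg : ∀ i < m, g i < Fintype.card V := fun i hi =>
    (hfan _ (by omega) (hle i hi _ (hf1 i hi))).1
  have hsub : ((insert (x k) ((Finset.range m).image fun i => x (g i)) : Finset V) : Set V) ⊆
      monoComponent G col (x k) := by
    intro w hw
    simp only [Finset.coe_insert, Finset.coe_image, Set.mem_insert_iff, Set.mem_image,
      Finset.mem_coe, Finset.mem_range] at hw
    rcases hw with rfl | ⟨i, hi, rfl⟩
    · exact SimpleGraph.Reachable.refl _
    · exact (op_mono_adj G col (hfan _ (by omega) (hle i hi _ (hf1 i hi))).2
        (hf2 i hi).symm).reachable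
  have h1 := Set.ncard_le_ncard hsub (Set.toFinite _)
  rw [Set.ncard_coe_finset, Finset.card_insert_of_notMem, Finset.card_image_of_injOn,
    Finset.card_range] at h1
  · have := hm (x k); omega
  · intro i hi j hj e
    simp only [Finset.coe_range, Set.mem_Iio] at hi hj
    have e' : g i = g j := hx (hg i hi) (hg j hj) e
    simp only [g] at e'
    have a1 := hf1 i hi
    have a2 := hf1 j hj
    rcases lt_trichotomy i j with h | h | h
    · have : (i + 1) * (m + 1) ≤ j * (m + 1) := Nat.mul_le_mul_right _ h
      nlinarith
    · exact h
    · have : (j + 1) * (m + 1) ≤ i * (m + 1) := Nat.mul_le_mul_right _ h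
      nlinarith
  · intro hmem
    simp only [Finset.mem_image, Finset.mem_range] at hmem
    obtain ⟨i, hi, e⟩ := hmem
    have e' : g i = k := hx (hg i hi) hk e
    simp only [g] at e'
    omega

/-- There is a constant `c > 0` such that for every outerpath with maximum degree
`Δ ≥ 4`, in every 2-coloring some monochromatic connected component has at least
`c * √Δ` vertices. -/
theorem outerpath_mcc2_lower :
    ∃ c : ℝ, 0 < c ∧
      ∀ (V : Type) [Fintype V] (G : SimpleGraph V) [DecidableRel G.Adj],
        IsOuterpath G → 4 ≤ G.maxDegree →
        ∀ col : V → Fin 2,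
          ∃ v : V, c * Real.sqrt G.maxDegree ≤ ((monoComponent G col v).ncard : ℝ) := by
  refine ⟨1 / 2, by norm_num, ?_⟩
  intro V _ G _ hG _ col
  have hne : Nonempty V := Fintype.card_pos_iff.1 (by have := hG.1; omega)
  obtain ⟨v, hv⟩ := Finite.exists_max (fun v => (monoComponent G col v).ncard)
  refine ⟨v, ?_⟩
  have hb := op_bound G hG col _ hv
  have hpos : 1 ≤ (monoComponent G col v).ncard :=
    (Set.ncard_pos (Set.toFinite _)).2 ⟨v, SimpleGraph.Reachable.refl _⟩
  generalize (monoComponent G col v).ncard = m at *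
  have h4 : G.maxDegree ≤ (2 * m) ^ 2 := by nlinarith
  have h5 : Real.sqrt G.maxDegree ≤ 2 * m := by
    rw [Real.sqrt_le_left (by positivity)]
    exact_mod_cast h4
  linarith
end

section
/- For every integer k ≥ 1, the number of internal (non-outer) vertices of the complete planar 3-tree T_k with k levels that are adjacent to at least one of the three outer vertices equals 3·2^k − 3k − 2. -/
/-- Vertices of the (infinite) complete planar 3-tree: the three outer vertices
`Sum.inl i`, and one vertex `Sum.inr s` for every internal face, where the face
inserted as child `j` of the face `s` is encoded `j :: s` (the root face is `[]`).
The vertex `Sum.inr s` is the central vertex inserted into the face `s`. -/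
abbrev CP3V : Type := Fin 3 ⊕ List (Fin 3)

/-- The three corner vertices of the face `s`: the root face `[]` has the three outer
vertices as corners; the child face `j :: s` keeps the corners `i ≠ j` of `s` and
replaces corner `j` by the central vertex of `s`. -/
def cp3corner : List (Fin 3) → Fin 3 → CP3V
  | [], i => Sum.inl i
  | j :: s, i => if i = j then Sum.inr s else cp3corner s i

/-- The infinite complete planar 3-tree: the three outer vertices are mutually adjacent,
and the central vertex of a face `s` is adjacent exactly to the three corners of `s`. -/
def cp3 : SimpleGraph CP3V :=
  SimpleGraph.fromRel (fun u v =>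
    (∃ i j : Fin 3, u = Sum.inl i ∧ v = Sum.inl j) ∨
    (∃ (s : List (Fin 3)) (i : Fin 3), u = Sum.inr s ∧ cp3corner s i = v))

/-- The level of a vertex: outer vertices are at level `0`; the central vertex of a face
`s` is at level `s.length + 1`. -/
def cp3level : CP3V → ℕ
  | Sum.inl _ => 0
  | Sum.inr s => s.length + 1

/-- The vertex set of the complete planar 3-tree `T k` with `k` levels. -/
def cp3verts (k : ℕ) : Set CP3V := {v | cp3level v ≤ k}

/-- The complete planar 3-tree `T k` with `k` levels. -/
def cp3tree (k : ℕ) : SimpleGraph (cp3verts k) :=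
  SimpleGraph.induce (cp3verts k) cp3

/-- The outer vertex `v_i` as a vertex of `T k`. -/
def cp3outer (k : ℕ) (i : Fin 3) : cp3verts k :=
  ⟨Sum.inl i, Nat.zero_le k⟩

/-- Lists of length `< k` with all entries in `A`. -/
def cp3G (A : Finset (Fin 3)) : ℕ → Finset (List (Fin 3))
  | 0 => ∅
  | k + 1 => insert [] ((A ×ˢ cp3G A k).image (fun p => p.1 :: p.2))

theorem mem_cp3G (A : Finset (Fin 3)) (k : ℕ) (s : List (Fin 3)) :
    s ∈ cp3G A k ↔ s.length < k ∧ ∀ x ∈ s, x ∈ A := by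
  induction k generalizing s with
  | zero => simp [cp3G]
  | succ k ih =>
    cases s with
    | nil => simp [cp3G]
    | cons a t =>
      simp only [cp3G, Finset.mem_insert, Finset.mem_image, Finset.mem_product, Prod.exists, ih]
      simp
      tauto

theorem card_cp3G (A : Finset (Fin 3)) (k : ℕ) :
    (cp3G A (k + 1)).card = A.card * (cp3G A k).card + 1 := by
  rw [cp3G, Finset.card_insert_of_notMem (by simp), Finset.card_image_of_injective, Finset.card_product]
  rintro ⟨a, b⟩ ⟨c, d⟩ h
  simpa using h

theorem cp3G_inter (A B : Finset (Fin 3)) (k : ℕ) :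
    cp3G A k ∩ cp3G B k = cp3G (A ∩ B) k := by
  ext s
  simp only [Finset.mem_inter, mem_cp3G]
  grind

theorem cp3G_two (A : Finset (Fin 3)) (h : A.card = 2) (k : ℕ) :
    (cp3G A k).card + 1 = 2 ^ k := by
  induction k with
  | zero => simp [cp3G]
  | succ k ih => rw [card_cp3G, h, pow_succ]; omega

theorem cp3G_one (A : Finset (Fin 3)) (h : A.card = 1) (k : ℕ) :
    (cp3G A k).card = k := by
  induction k with
  | zero => simp [cp3G]
  | succ k ih => rw [card_cp3G, h, ih]; omega

theorem cp3G_zero (A : Finset (Fin 3)) (h : A.card = 0) (k : ℕ) (hk : 1 ≤ k) :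
    (cp3G A k).card = 1 := by
  obtain ⟨k, rfl⟩ := Nat.exists_eq_add_of_le' hk
  rw [card_cp3G, h]; omega

theorem cp3corner_eq_inl (s : List (Fin 3)) (i j : Fin 3) :
    cp3corner s i = Sum.inl j ↔ i = j ∧ i ∉ s := by
  induction s with
  | nil => simp [cp3corner]
  | cons a t ih =>
    by_cases h : i = a <;> simp [cp3corner, h]
    exact ih

theorem cp3_adj_inl_inr (s : List (Fin 3)) (i : Fin 3) :
    cp3.Adj (Sum.inl i) (Sum.inr s) ↔ i ∉ s := by
  simp [cp3, cp3corner_eq_inl]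

/-- For every `k ≥ 1`, the number of internal (non-outer) vertices of the complete
planar 3-tree with `k` levels adjacent to at least one of the three outer vertices is
`3 * 2 ^ k - 3 * k - 2`. -/
theorem cp3tree_internal_neighbors_of_outer :
    ∀ k : ℕ, 1 ≤ k →
      {u : CP3V | u ∈ cp3verts k ∧ 1 ≤ cp3level u ∧
          ∃ i : Fin 3, cp3.Adj (Sum.inl i) u}.ncard
        = 3 * 2 ^ k - 3 * k - 2 := by
  intro k hk
  have hset : {u : CP3V | u ∈ cp3verts k ∧ 1 ≤ cp3level u ∧
          ∃ i : Fin 3, cp3.Adj (Sum.inl i) u} =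
      Sum.inr '' (↑((cp3G {1, 2} k ∪ cp3G {0, 2} k) ∪ cp3G {0, 1} k) : Set (List (Fin 3))) := by
    ext u
    rcases u with i | s
    · simp [cp3level]
    · have e0 : (0 ∉ s) ↔ ∀ x ∈ s, x ∈ ({1, 2} : Finset (Fin 3)) := by
        constructor
        · intro h x hx; fin_cases x <;> simp_all
        · intro h hx; simpa using h _ hx
      have e1 : (1 ∉ s) ↔ ∀ x ∈ s, x ∈ ({0, 2} : Finset (Fin 3)) := by
        constructor
        · intro h x hx; fin_cases x <;> simp_all
        · intro h hx; simpa using h _ hx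
      have e2 : (2 ∉ s) ↔ ∀ x ∈ s, x ∈ ({0, 1} : Finset (Fin 3)) := by
        constructor
        · intro h x hx; fin_cases x <;> simp_all
        · intro h hx; simpa using h _ hx
      have hm : (Sum.inr s : CP3V) ∈ Sum.inr ''
          (↑((cp3G {1, 2} k ∪ cp3G {0, 2} k) ∪ cp3G {0, 1} k) : Set (List (Fin 3))) ↔
          s ∈ (cp3G {1, 2} k ∪ cp3G {0, 2} k) ∪ cp3G {0, 1} k := by
        rw [Sum.inr_injective.mem_set_image, Finset.mem_coe]
      rw [hm]
      simp only [Finset.mem_union, mem_cp3G, ← e0, ← e1, ← e2, Set.mem_ofPred_eq, cp3verts,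
        cp3level, cp3_adj_inl_inr, Fin.exists_fin_succ, Nat.lt_iff_add_one_le]
      simp
      tauto
  rw [hset, Set.ncard_image_of_injective _ Sum.inr_injective, Set.ncard_coe_finset]
  have h1 := Finset.card_union_add_card_inter (cp3G {1, 2} k ∪ cp3G {0, 2} k) (cp3G {0, 1} k)
  have h2 := Finset.card_union_add_card_inter (cp3G {1, 2} k) (cp3G {0, 2} k)
  have h3 := Finset.card_union_add_card_inter (cp3G {1, 2} k ∩ cp3G {0, 1} k)
    (cp3G {0, 2} k ∩ cp3G {0, 1} k)
  rw [Finset.union_inter_distrib_right] at h1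
  simp only [cp3G_inter] at h1 h2 h3
  rw [cp3G_one ({1, 2} ∩ {0, 2}) (by decide)] at h2
  rw [cp3G_one ({1, 2} ∩ {0, 1}) (by decide), cp3G_one ({0, 2} ∩ {0, 1}) (by decide),
    cp3G_zero _ (by decide) k hk] at h3
  have a := cp3G_two {1, 2} (by decide) k
  have b := cp3G_two {0, 2} (by decide) k
  have c := cp3G_two {0, 1} (by decide) k
  omega
end

section
/- Let T_k be the complete planar 3-tree with k levels (k ≥ 0) and suppose its vertices are colored with 3 colors so that the three outer vertices receive three distinct colors. Then there exists a monochromatic path in T_k of length at least k/3 (i.e., with at least k/3 edges) one of whose endpoints is an outer vertex of T_k. -/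
theorem cp3_aux (k : ℕ) (col : cp3verts k → Fin 3)
    (hc : ∀ i j : Fin 3, i ≠ j → col (cp3outer k i) ≠ col (cp3outer k j)) :
    ∀ n ≤ k, ∃ s : List (Fin 3), s.length = n ∧ ∃ L : Fin 3 → ℕ, (∑ i, L i) = n ∧
      ∀ i, ∃ (v : cp3verts k) (p : (cp3tree k).Walk (cp3outer k i) v),
        v.1 = cp3corner s i ∧ p.IsPath ∧ (∀ w ∈ p.support, col w = col (cp3outer k i)) ∧
        (∀ w ∈ p.support, cp3level w.1 ≤ n) ∧ p.length = L i := by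
  intro n
  induction n with
  | zero =>
    intro _
    refine ⟨[], rfl, fun _ => 0, by simp, fun i => ⟨cp3outer k i, .nil, rfl, by simp, by simp, ?_, rfl⟩⟩
    simp [cp3outer, cp3level]
  | succ n ih =>
    intro hn
    obtain ⟨s, hs, L, hL, H⟩ := ih (by omega)
    have hinj : Function.Injective (fun i => col (cp3outer k i)) := by
      intro i j h
      by_contra hne
      exact hc i j hne h
    have hu : Sum.inr s ∈ cp3verts k := by
      change s.length + 1 ≤ k
      omega
    obtain ⟨j, hj⟩ := (Finite.injective_iff_surjective.mp hinj) (col ⟨Sum.inr s, hu⟩)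
    refine ⟨j :: s, by simp [hs], fun i => L i + if i = j then 1 else 0, ?_, ?_⟩
    · simp [Finset.sum_add_distrib, hL]
    intro i
    obtain ⟨v, p, hv, hp, hm, hl, hlen⟩ := H i
    by_cases hij : i = j
    · subst hij
      have hnot : (⟨Sum.inr s, hu⟩ : cp3verts k) ∉ p.support := by
        intro hmem
        have := hl _ hmem
        simp [cp3level] at this
        omega
      have hadj : (cp3tree k).Adj v ⟨Sum.inr s, hu⟩ := by
        have hne : v.1 ≠ Sum.inr s := by
          intro h
          apply hnot
          have : v = ⟨Sum.inr s, hu⟩ := Subtype.ext h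
          rw [← this]
          exact p.end_mem_support
        change cp3.Adj v.1 (Sum.inr s)
        rw [cp3, SimpleGraph.fromRel_adj]
        exact ⟨hne, Or.inr (Or.inr ⟨s, i, rfl, hv.symm⟩)⟩
      refine ⟨⟨Sum.inr s, hu⟩, p.concat hadj, by simp [cp3corner], hp.concat hnot hadj, ?_, ?_, by simp [hlen]⟩
      · intro w hw
        rw [SimpleGraph.Walk.support_concat] at hw
        simp only [List.concat_eq_append, List.mem_append, List.mem_singleton] at hw
        rcases hw with hw | rfl
        · exact hm w hw
        · exact hj.symm
      · intro w hw
        rw [SimpleGraph.Walk.support_concat] at hw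
        simp only [List.concat_eq_append, List.mem_append, List.mem_singleton] at hw
        rcases hw with hw | rfl
        · exact (hl w hw).trans (by omega)
        · simp [cp3level, hs]
    · exact ⟨v, p, by simp [cp3corner, hij, hv], hp, hm, fun w hw => (hl w hw).trans (by omega), by simp [hij, hlen]⟩

/-- If the vertices of the complete planar 3-tree with `k` levels are 3-colored so that
the three outer vertices get three distinct colors, then there is a monochromatic path
with at least `k / 3` edges one of whose endpoints is an outer vertex. -/
theorem cp3tree_monochromatic_path :
    ∀ (k : ℕ) (col : cp3verts k → Fin 3),
      (∀ i j : Fin 3, i ≠ j → col (cp3outer k i) ≠ col (cp3outer k j)) →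
      ∃ (i : Fin 3) (v : cp3verts k) (p : (cp3tree k).Walk (cp3outer k i) v),
        p.IsPath ∧ (∀ w ∈ p.support, col w = col (cp3outer k i)) ∧ k ≤ 3 * p.length := by
  intro k col hc
  obtain ⟨s, -, L, hL, H⟩ := cp3_aux k col hc k le_rfl
  have : ∃ i, k ≤ 3 * L i := by
    by_contra! h
    have h0 := h 0
    have h1 := h 1
    have h2 := h 2
    rw [Fin.sum_univ_three] at hL
    omega
  obtain ⟨i, hi⟩ := this
  obtain ⟨v, p, -, hp, hm, -, hlen⟩ := H i
  exact ⟨i, v, p, hp, hm, by omega⟩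
end

section
/- There exists a constant c > 0 such that for every integer k ≥ 1 the complete planar 3-tree T_k with k levels and n = (3^k+5)/2 vertices satisfies mcc_3(T_k) ≥ c·log n; that is, in every 3-coloring of the vertices of T_k some monochromatic connected component has at least c·log n vertices. -/
theorem cp3corner_level (s : List (Fin 3)) (i : Fin 3) : cp3level (cp3corner s i) ≤ s.length := by
  induction s with
  | nil => simp [cp3corner, cp3level]
  | cons j s ih =>
    simp only [cp3corner]
    split_ifs
    · simp [cp3level]
    · simp only [List.length_cons]; omega

theorem cp3center_adj (s : List (Fin 3)) (i : Fin 3) :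
    cp3.Adj (Sum.inr s) (cp3corner s i) := by
  rw [cp3, SimpleGraph.fromRel_adj]
  refine ⟨?_, Or.inl (Or.inr ⟨s, i, rfl, rfl⟩)⟩
  intro h
  have := cp3corner_level s i
  rw [← h] at this
  simp [cp3level] at this

theorem cp3corner_adj (s : List (Fin 3)) (i j : Fin 3) (h : i ≠ j) :
    cp3.Adj (cp3corner s i) (cp3corner s j) := by
  induction s with
  | nil =>
    rw [cp3, SimpleGraph.fromRel_adj]
    exact ⟨by simpa [cp3corner] using h, Or.inl (Or.inl ⟨i, j, rfl, rfl⟩)⟩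
  | cons l s ih =>
    simp only [cp3corner]
    split_ifs with h1 h2 h2
    · exact absurd (h1.trans h2.symm) h
    · exact cp3center_adj s j
    · exact (cp3center_adj s i).symm
    · exact ih

theorem mono_adj_reach (k : ℕ) (col : cp3verts k → Fin 3) (a b : cp3verts k)
    (h : cp3.Adj a.1 b.1) (hc : col a = col b) :
    (monoSubgraph (cp3tree k) col).Reachable a b := by
  apply SimpleGraph.Adj.reachable
  rw [monoSubgraph, SimpleGraph.fromRel_adj]
  exact ⟨fun e => h.ne (congrArg Subtype.val e), Or.inl ⟨h, hc⟩⟩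

theorem cp3verts_finite (k : ℕ) : (cp3verts k).Finite := by
  have h := (List.finite_length_le (Fin 3) k)
  refine ((Set.finite_range (Sum.inl : Fin 3 → CP3V)).union (h.image Sum.inr)).subset ?_
  rintro (i | s) hs
  · exact Or.inl ⟨i, rfl⟩
  · right
    refine ⟨s, ?_, rfl⟩
    simp only [cp3verts, cp3level, Set.mem_setOf_eq] at hs ⊢
    omega

theorem cp3_invariant (k : ℕ) (col : cp3verts k → Fin 3) (d : ℕ) (hd : d ≤ k) :
    ∃ (s : List (Fin 3)) (f : Fin 3 → cp3verts k) (A : Finset (cp3verts k)),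
      s.length = d ∧ (∀ i, (f i).1 = cp3corner s i) ∧ A.card = d ∧
      (∀ u ∈ A, cp3level u.1 ≤ d) ∧
      ∀ u ∈ A, ∃ i, (monoSubgraph (cp3tree k) col).Reachable (f i) u := by
  classical
  induction d with
  | zero => exact ⟨[], cp3outer k, ∅, rfl, fun i => rfl, rfl, by simp, by simp⟩
  | succ d ih =>
    obtain ⟨s, f, A, hs, hf, hA, hl, hr⟩ := ih (by omega)
    have hv : cp3level (Sum.inr s) = d + 1 := by simp [cp3level, hs]
    let v : cp3verts k := ⟨Sum.inr s, by simp only [cp3verts, Set.mem_setOf_eq, hv]; exact hd⟩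
    have hvA : v ∉ A := fun h => by
      have := hl v h
      simp only [v, hv] at this
      omega
    -- a corner which may be replaced
    have key : ∃ j, ∃ g : cp3verts k, (g = v ∨ ∃ i, i ≠ j ∧ g = f i) ∧
        (monoSubgraph (cp3tree k) col).Reachable g (f j) := by
      by_cases h : ∃ j, col v = col (f j)
      · obtain ⟨j, hj⟩ := h
        refine ⟨j, v, Or.inl rfl, mono_adj_reach k col _ _ ?_ hj⟩
        rw [hf]; exact cp3center_adj s j
      · have hni : ¬ Function.Injective (fun i => col (f i)) := by
          intro hi
          obtain ⟨j, hj⟩ := (Finite.surjective_of_injective hi) (col v)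
          exact h ⟨j, hj.symm⟩
        simp only [Function.Injective, not_forall] at hni
        obtain ⟨i, j, hij, hne⟩ := hni
        refine ⟨j, f i, Or.inr ⟨i, hne, rfl⟩, mono_adj_reach k col _ _ ?_ hij⟩
        rw [hf, hf]; exact cp3corner_adj s i j hne
    obtain ⟨j, g, hg, hgr⟩ := key
    refine ⟨j :: s, fun i => if i = j then v else f i, insert v A, by simp [hs], ?_, ?_, ?_, ?_⟩
    · intro i
      simp only [cp3corner]
      split_ifs
      · rfl
      · exact hf i
    · rw [Finset.card_insert_of_notMem hvA, hA]
    · intro u hu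
      rcases Finset.mem_insert.1 hu with rfl | hu
      · exact hv.le
      · have := hl u hu; omega
    · intro u hu
      rcases Finset.mem_insert.1 hu with rfl | hu
      · exact ⟨j, by simp⟩
      · obtain ⟨i, hi⟩ := hr u hu
        by_cases hij : i = j
        · subst hij
          rcases hg with rfl | ⟨i', hne, rfl⟩
          · exact ⟨i, by simpa using hgr.trans hi⟩
          · exact ⟨i', by simpa [hne] using hgr.trans hi⟩
        · exact ⟨i, by simpa [hij] using hi⟩

/-- There is a constant `c > 0` such that for every `k ≥ 1`, in every 3-coloring of the
complete planar 3-tree with `k` levels and `n = (3 ^ k + 5) / 2` vertices, some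
monochromatic connected component has at least `c * log n` vertices. -/
theorem cp3tree_mcc3_lower :
    ∃ c : ℝ, 0 < c ∧ ∀ k : ℕ, 1 ≤ k →
      ∀ col : cp3verts k → Fin 3,
        ∃ v : cp3verts k,
          c * Real.log (((3 ^ k + 5) / 2 : ℕ) : ℝ)
            ≤ ((monoComponent (cp3tree k) col v).ncard : ℝ) := by
  refine ⟨1 / 12, by norm_num, fun k hk col => ?_⟩
  obtain ⟨s, f, A, -, -, hA, -, hr⟩ := cp3_invariant k col k le_rfl
  have : Finite (cp3verts k) := (cp3verts_finite k).to_subtype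
  have hsub : (A : Set (cp3verts k)) ⊆ monoComponent (cp3tree k) col (f 0) ∪
      monoComponent (cp3tree k) col (f 1) ∪ monoComponent (cp3tree k) col (f 2) := by
    intro u hu
    obtain ⟨i, hi⟩ := hr u hu
    fin_cases i
    · exact Or.inl (Or.inl hi)
    · exact Or.inl (Or.inr hi)
    · exact Or.inr hi
  have h1 := Set.ncard_le_ncard hsub (Set.toFinite _)
  rw [Set.ncard_coe_finset, hA] at h1
  have h2 := Set.ncard_union_le (monoComponent (cp3tree k) col (f 0) ∪
      monoComponent (cp3tree k) col (f 1)) (monoComponent (cp3tree k) col (f 2))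
  have h3 := Set.ncard_union_le (monoComponent (cp3tree k) col (f 0))
      (monoComponent (cp3tree k) col (f 1))
  have h4 : ∃ i, k ≤ 3 * (monoComponent (cp3tree k) col (f i)).ncard := by
    by_contra! h
    have := h 0
    have := h 1
    have := h 2
    omega
  obtain ⟨i, hi⟩ := h4
  refine ⟨f i, ?_⟩
  have hi' : (k : ℝ) ≤ 3 * ((monoComponent (cp3tree k) col (f i)).ncard : ℝ) := by
    exact_mod_cast hi
  have hn : (3 ^ k + 5) / 2 ≤ 3 ^ (k + 1) := by
    have : 1 ≤ 3 ^ k := Nat.one_le_pow _ _ (by norm_num)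
    rw [pow_succ]; omega
  have hlog : Real.log (((3 ^ k + 5) / 2 : ℕ) : ℝ) ≤ (k + 1) * Real.log 3 := by
    have hpos : 0 < (3 ^ k + 5) / 2 := by omega
    calc _ ≤ Real.log ((3 : ℝ) ^ (k + 1)) :=
          Real.log_le_log (by exact_mod_cast hpos) (by exact_mod_cast hn)
      _ = _ := by rw [Real.log_pow]; push_cast; ring
  have hl3 : Real.log 3 ≤ 2 := by
    have := Real.log_le_sub_one_of_pos (show (0 : ℝ) < 3 by norm_num)
    linarith
  have hk' : (1 : ℝ) ≤ k := by exact_mod_cast hk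
  nlinarith
end

section
/- There exists a constant C > 0 such that for every integer k ≥ 1 the complete planar 3-tree T_k with k levels and n = (3^k+5)/2 vertices satisfies mcc_2(T_k) ≤ C·n^{1/log₂6} (note 1/log₂6 ≈ 0.387); equivalently, mcc_2(T_k) ≤ C·3^{k/log₂6}. That is, the vertices of T_k can be 2-colored so that every monochromatic connected component has at most C·n^{1/log₂6} vertices. -/
abbrev LB : Type := Option (List (Fin 3)) × Bool

/-- label and colour of the centre of the face `s` given those of its corners -/
def cenv (d : ℕ) (s : List (Fin 3)) (F : Fin 3 → LB) : LB :=
  if s.length < d then (none, false)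
  else if ∀ i, F i = F 0 then (some s, !(F 0).2)
  else match s with
    | [] => (none, false)
    | j :: _ => F j

def fsv (d : ℕ) : List (Fin 3) → Fin 3 → LB
  | [], _ => (none, false)
  | j :: t, i => if i = j then cenv d t (fsv d t) else fsv d t i

def lbv (d : ℕ) : CP3V → LB
  | Sum.inl _ => (none, false)
  | Sum.inr s => cenv d s (fsv d s)

lemma lbv_corner (d : ℕ) (s : List (Fin 3)) (i : Fin 3) :
    lbv d (cp3corner s i) = fsv d s i := by
  induction s with
  | nil => rfl
  | cons j t ih =>
    simp only [cp3corner, fsv]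
    split_ifs
    · rfl
    · exact ih

lemma fsv_le (d : ℕ) (s : List (Fin 3)) (h : s.length ≤ d) (i : Fin 3) :
    fsv d s i = (none, false) := by
  induction s with
  | nil => rfl
  | cons j t ih =>
    simp only [List.length_cons] at h
    simp only [fsv]
    split_ifs
    · simp [cenv, show t.length < d by omega]
    · exact ih (by omega)

/-- the three possibilities for the centre -/
lemma cen_cases (d : ℕ) (s : List (Fin 3)) :
    (s.length < d ∧ lbv d (Sum.inr s) = (none, false) ∧ ∀ i, fsv d s i = (none, false)) ∨
    (d ≤ s.length ∧ (∀ i, fsv d s i = fsv d s 0) ∧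
      lbv d (Sum.inr s) = (some s, !(fsv d s 0).2)) ∨
    (d ≤ s.length ∧ (¬ ∀ i, fsv d s i = fsv d s 0) ∧
      ∃ j t, s = j :: t ∧ d ≤ t.length ∧ lbv d (Sum.inr s) = fsv d s j ∧
        lbv d (Sum.inr s) = lbv d (Sum.inr t)) := by
  by_cases h : s.length < d
  · left
    exact ⟨h, by simp [lbv, cenv, h], fsv_le d s h.le⟩
  right
  by_cases hm : ∀ i, fsv d s i = fsv d s 0
  · left
    refine ⟨by omega, hm, ?_⟩
    simp only [lbv, cenv, if_neg h, if_pos hm]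
  right
  refine ⟨by omega, hm, ?_⟩
  cases s with
  | nil => exact absurd (fun i => rfl) hm
  | cons j t =>
    refine ⟨j, t, rfl, ?_, ?_, ?_⟩
    · by_contra hlt
      apply hm
      intro i
      rw [fsv_le d _ (by simp; omega), fsv_le d _ (by simp; omega)]
    · simp only [lbv]
      rw [cenv, if_neg h, if_neg hm]
    · simp only [lbv]
      rw [cenv, if_neg h, if_neg hm]
      simp [fsv]

lemma cen_consist (d : ℕ) (s : List (Fin 3))
    (inv : ∀ i i', (fsv d s i).2 = (fsv d s i').2 → fsv d s i = fsv d s i') (i : Fin 3)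
    (h : (lbv d (Sum.inr s)).2 = (fsv d s i).2) : lbv d (Sum.inr s) = fsv d s i := by
  rcases cen_cases d s with ⟨_, h1, h2⟩ | ⟨_, h1, h2⟩ | ⟨_, _, j, t, _, _, h1, _⟩
  · rw [h1, h2]
  · rw [h2, h1 i] at h
    simp at h
  · rw [h1] at h ⊢
    exact inv _ _ h

lemma face_inv (d : ℕ) (s : List (Fin 3)) :
    ∀ i i', (fsv d s i).2 = (fsv d s i').2 → fsv d s i = fsv d s i' := by
  induction s with
  | nil => intro i i' _; rfl
  | cons j t ih =>
    have hc := cen_consist d t ih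
    simp only [lbv] at hc
    intro i i' h
    simp only [fsv] at h ⊢
    split_ifs at h ⊢
    · rfl
    · exact hc _ h
    · exact (hc _ h.symm).symm
    · exact ih _ _ h

lemma adj_label (d : ℕ) (u v : CP3V) (h : cp3.Adj u v) (hc : (lbv d u).2 = (lbv d v).2) :
    lbv d u = lbv d v := by
  have key : ∀ u v : CP3V, ((∃ i j : Fin 3, u = Sum.inl i ∧ v = Sum.inl j) ∨
    (∃ (s : List (Fin 3)) (i : Fin 3), u = Sum.inr s ∧ cp3corner s i = v)) →
    (lbv d u).2 = (lbv d v).2 → lbv d u = lbv d v := by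
    rintro u v (⟨i, j, rfl, rfl⟩ | ⟨s, i, rfl, rfl⟩) h
    · rfl
    · rw [lbv_corner] at h ⊢
      exact cen_consist d s (face_inv d s) i h
  rw [cp3, SimpleGraph.fromRel_adj] at h
  rcases h.2 with h | h
  · exact key _ _ h hc
  · exact (key _ _ h hc.symm).symm

lemma label_none (d : ℕ) (s : List (Fin 3)) (h : (lbv d (Sum.inr s)).1 = none) :
    s.length < d := by
  induction s with
  | nil =>
    rcases cen_cases d [] with ⟨h0, _⟩ | ⟨_, h1, h2⟩ | ⟨_, _, j, t, h1, _⟩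
    · exact h0
    · rw [h2] at h; simp at h
    · simp at h1
  | cons a t ih =>
    rcases cen_cases d (a :: t) with ⟨h0, _⟩ | ⟨_, h1, h2⟩ | ⟨_, _, j, t', h1, h2, _, h3⟩
    · exact h0
    · rw [h2] at h; simp at h
    · obtain ⟨rfl, rfl⟩ := List.cons.inj h1
      rw [h3] at h
      have := ih h
      omega

lemma label_some (d : ℕ) (b s : List (Fin 3)) (h : (lbv d (Sum.inr s)).1 = some b) :
    d ≤ b.length ∧ ∃ u, s = u ++ b ∧ (∃ j, j ∉ u) ∧
      ∀ i ∈ u, fsv d s i = lbv d (Sum.inr s) := by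
  induction s with
  | nil =>
    rcases cen_cases d [] with ⟨_, h0, _⟩ | ⟨h0, h1, h2⟩ | ⟨_, _, j, t, h1, _⟩
    · rw [h0] at h; simp at h
    · rw [h2] at h
      simp only [Option.some.injEq] at h
      subst h
      exact ⟨h0, [], rfl, ⟨0, by simp⟩, by simp⟩
    · simp at h1
  | cons a t ih =>
    rcases cen_cases d (a :: t) with ⟨_, h0, _⟩ | ⟨h0, h1, h2⟩ | ⟨_, hm, j, t', h1, h2, _, h3⟩
    · rw [h0] at h; simp at h
    · rw [h2] at h
      simp only [Option.some.injEq] at h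
      subst h
      exact ⟨h0, [], rfl, ⟨0, by simp⟩, by simp⟩
    · obtain ⟨rfl, rfl⟩ := List.cons.inj h1
      rw [h3] at h
      obtain ⟨hb, u, hu, _, hf⟩ := ih h
      have hall : ∀ i ∈ a :: u, fsv d (a :: t) i = lbv d (Sum.inr (a :: t)) := by
        intro i hi
        rw [h3]
        by_cases hia : i = a
        · simp [fsv, hia, lbv]
        · have hiu : i ∈ u := by simpa [hia] using hi
          simp only [fsv, if_neg hia]
          exact hf i hiu
      refine ⟨hb, a :: u, by simp [hu], ?_, hall⟩
      by_contra hcon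
      push Not at hcon
      exact hm fun i => by rw [hall i (hcon i), hall 0 (hcon 0)]

/-- lists with entries in `A` of length less than `r` -/
def lsts (A : Finset (Fin 3)) : ℕ → Finset (List (Fin 3))
  | 0 => ∅
  | r + 1 => insert [] ((A ×ˢ lsts A r).image fun p => p.1 :: p.2)

lemma lsts_card (A : Finset (Fin 3)) (hA : 2 ≤ A.card) (r : ℕ) :
    (lsts A r).card + 1 ≤ A.card ^ r := by
  induction r with
  | zero => simp [lsts]
  | succ r ih =>
    have h1 := Finset.card_insert_le ([] : List (Fin 3))
      ((A ×ˢ lsts A r).image fun p => p.1 :: p.2)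
    have h2 : ((A ×ˢ lsts A r).image fun p => p.1 :: p.2).card ≤ A.card * (lsts A r).card := by
      rw [← Finset.card_product]
      exact Finset.card_image_le
    simp only [lsts]
    rw [pow_succ]
    nlinarith

lemma mem_lsts (A : Finset (Fin 3)) (r : ℕ) (u : List (Fin 3)) (h : u.length < r)
    (hu : ∀ i ∈ u, i ∈ A) : u ∈ lsts A r := by
  induction r generalizing u with
  | zero => omega
  | succ r ih =>
    cases u with
    | nil => simp [lsts]
    | cons a u =>
      simp only [List.length_cons] at h
      simp only [lsts, Finset.mem_insert, Finset.mem_image, Finset.mem_product]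
      right
      exact ⟨(a, u), ⟨hu a (by simp), ih u (by omega) fun i hi => hu i (by simp [hi])⟩, rfl⟩

lemma fiber_bound (k d : ℕ) (hd : d ≤ k) (ℓ : Option (List (Fin 3))) :
    ∃ T : Finset CP3V, T.card ≤ 3 + 3 ^ d + 3 * 2 ^ (k - d) ∧
      ∀ v, cp3level v ≤ k → (lbv d v).1 = ℓ → v ∈ T := by
  classical
  cases ℓ with
  | none =>
    refine ⟨Finset.univ.image Sum.inl ∪ (lsts Finset.univ d).image Sum.inr, ?_, ?_⟩
    · have h1 := Finset.card_union_le ((Finset.univ : Finset (Fin 3)).image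
        (Sum.inl : Fin 3 → CP3V)) ((lsts Finset.univ d).image Sum.inr)
      have h2 : ((Finset.univ : Finset (Fin 3)).image (Sum.inl : Fin 3 → CP3V)).card ≤ 3 :=
        Finset.card_image_le
      have h3 : ((lsts Finset.univ d).image (Sum.inr : _ → CP3V)).card ≤ _ :=
        Finset.card_image_le
      have h4 := lsts_card Finset.univ (by simp) d
      simp only [Finset.card_univ, Fintype.card_fin] at h4
      omega
    · rintro (i | s) hv hl
      · simp
      · have := label_none d s hl
        simp only [Finset.mem_union, Finset.mem_image]
        right
        exact ⟨s, mem_lsts _ _ _ this (by simp), rfl⟩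
  | some b =>
    refine ⟨Finset.univ.biUnion fun j : Fin 3 =>
      (lsts (Finset.univ.erase j) (k - d)).image fun u => Sum.inr (u ++ b), ?_, ?_⟩
    · have h1 : ∀ j : Fin 3, ((lsts (Finset.univ.erase j) (k - d)).image
          fun u => (Sum.inr (u ++ b) : CP3V)).card ≤ 2 ^ (k - d) := by
        intro j
        have hc : (Finset.univ.erase j : Finset (Fin 3)).card = 2 := by simp
        have h3 := lsts_card (Finset.univ.erase j) hc.ge (k - d)
        rw [hc] at h3
        exact Finset.card_image_le.trans (by omega)
      have := Finset.card_biUnion_le_card_mul Finset.univ _ _ fun j _ => h1 j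
      simp only [Finset.card_univ, Fintype.card_fin] at this
      exact this.trans (Nat.le_add_left _ _)
    · rintro (i | s) hv hl
      · simp [lbv] at hl
      · obtain ⟨hb, u, rfl, ⟨j, hj⟩, _⟩ := label_some d b s hl
        simp only [cp3level, List.length_append] at hv
        simp only [Finset.mem_biUnion, Finset.mem_univ, true_and, Finset.mem_image]
        refine ⟨j, u, mem_lsts _ _ _ (by omega) ?_, rfl⟩
        intro i hi
        simp only [Finset.mem_erase, Finset.mem_univ, and_true]
        rintro rfl
        exact hj hi

lemma comp_bound (k d : ℕ) (hd : d ≤ k) :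
    ∃ col : cp3verts k → Fin 2, ∀ v : cp3verts k,
      (monoComponent (cp3tree k) col v).ncard ≤ 3 + 3 ^ d + 3 * 2 ^ (k - d) := by
  classical
  refine ⟨fun v => if (lbv d v.1).2 then 1 else 0, fun v => ?_⟩
  obtain ⟨T, hT, hmem⟩ := fiber_bound k d hd (lbv d v.1).1
  set col : cp3verts k → Fin 2 := fun v => if (lbv d v.1).2 then 1 else 0 with hcol
  have hcc : ∀ a b : cp3verts k, col a = col b → (lbv d a.1).2 = (lbv d b.1).2 := by
    intro a b h
    simp only [hcol] at h
    cases ha : (lbv d a.1).2 <;> cases hb : (lbv d b.1).2 <;> simp_all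
  have hadj : ∀ a b, (monoSubgraph (cp3tree k) col).Adj a b → lbv d a.1 = lbv d b.1 := by
    intro a b h
    rw [monoSubgraph, SimpleGraph.fromRel_adj] at h
    rcases h.2 with ⟨h1, h2⟩ | ⟨h1, h2⟩
    · exact adj_label d _ _ h1 (hcc _ _ h2)
    · exact (adj_label d _ _ h1 (hcc _ _ h2)).symm
  have hreach : ∀ u, (monoSubgraph (cp3tree k) col).Reachable v u → lbv d v.1 = lbv d u.1 := by
    have hw : ∀ a b, (monoSubgraph (cp3tree k) col).Walk a b → lbv d a.1 = lbv d b.1 := by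
      intro a b w
      induction w with
      | nil => rfl
      | cons h p ih => exact (hadj _ _ h).trans ih
    rintro u ⟨w⟩
    exact hw _ _ w
  have hsub : Subtype.val '' (monoComponent (cp3tree k) col v) ⊆ (T : Set CP3V) := by
    rintro _ ⟨u, hu, rfl⟩
    exact hmem u.1 u.2 (by rw [hreach u hu])
  rw [← Set.ncard_image_of_injective _ Subtype.val_injective]
  refine (Set.ncard_le_ncard hsub T.finite_toSet).trans ?_
  rw [Set.ncard_coe_finset]
  exact hT

lemma num_bound (k d : ℕ) (h : 6 ^ d ≤ 2 ^ k) :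
    (3 : ℝ) ^ d ≤ 2 * (((3 ^ k + 5) / 2 : ℕ) : ℝ) ^ ((1 : ℝ) / Real.logb 2 6) := by
  set e := (1 : ℝ) / Real.logb 2 6 with he
  have hl2 : 0 < Real.log 2 := Real.log_pos (by norm_num)
  have hl3 : 0 < Real.log 3 := Real.log_pos (by norm_num)
  have hl26 : Real.log 2 ≤ Real.log 6 := Real.log_le_log (by norm_num) (by norm_num)
  have hl6 : 0 < Real.log 6 := by linarith
  have he' : e = Real.log 2 / Real.log 6 := by rw [he, Real.logb]; field_simp
  have he0 : 0 ≤ e := by rw [he']; positivity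
  have he1 : e ≤ 1 := by rw [he']; exact (div_le_one hl6).2 hl26
  have h1 : (d : ℝ) * Real.log 6 ≤ k * Real.log 2 := by
    rw [← Real.log_pow, ← Real.log_pow]
    exact Real.log_le_log (by positivity) (by exact_mod_cast h)
  have h2 : (3 : ℝ) ^ d ≤ ((3 : ℝ) ^ k) ^ e := by
    rw [← Real.rpow_natCast, ← Real.rpow_natCast, ← Real.rpow_mul (by norm_num)]
    apply Real.rpow_le_rpow_of_exponent_le (by norm_num)
    rw [he', ← mul_div_assoc, le_div_iff₀ hl6]
    exact h1
  set n : ℕ := (3 ^ k + 5) / 2 with hn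
  have h3 : 3 ^ k ≤ 2 * n := by omega
  have h3' : (3 : ℝ) ^ k ≤ 2 * n := by exact_mod_cast h3
  calc (3 : ℝ) ^ d ≤ ((3 : ℝ) ^ k) ^ e := h2
    _ ≤ (2 * (n : ℝ)) ^ e := Real.rpow_le_rpow (by positivity) h3' he0
    _ = 2 ^ e * (n : ℝ) ^ e := Real.mul_rpow (by norm_num) (by positivity)
    _ ≤ 2 * (n : ℝ) ^ e := by
      gcongr
      calc (2 : ℝ) ^ e ≤ 2 ^ (1 : ℝ) := Real.rpow_le_rpow_of_exponent_le (by norm_num) he1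
        _ = 2 := Real.rpow_one 2

/-- There is a constant `C > 0` such that for every `k ≥ 1`, the complete planar 3-tree
with `k` levels and `n = (3 ^ k + 5) / 2` vertices can be 2-colored so that every
monochromatic connected component has at most `C * n ^ (1 / log₂ 6)` vertices. -/
theorem cp3tree_mcc2_upper :
    ∃ C : ℝ, 0 < C ∧ ∀ k : ℕ, 1 ≤ k →
      ∃ col : cp3verts k → Fin 2,
        ∀ v : cp3verts k,
          ((monoComponent (cp3tree k) col v).ncard : ℝ)
            ≤ C * (((3 ^ k + 5) / 2 : ℕ) : ℝ) ^ ((1 : ℝ) / Real.logb 2 6) := by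
  refine ⟨44, by norm_num, fun k _ => ?_⟩
  set d := Nat.log 6 (2 ^ k) with hd
  have h1 : 6 ^ d ≤ 2 ^ k := Nat.pow_log_le_self 6 (by positivity)
  have h2 : 2 ^ k < 6 ^ (d + 1) := Nat.lt_pow_succ_log_self (by norm_num) _
  have hdk : d ≤ k := by
    have : 2 ^ d ≤ 2 ^ k := (Nat.pow_le_pow_left (by norm_num) d).trans h1
    exact (Nat.pow_le_pow_iff_right (by norm_num)).1 this
  have h3 : 2 ^ (k - d) ≤ 6 * 3 ^ d := by
    have e1 : 2 ^ k = 2 ^ d * 2 ^ (k - d) := by rw [← pow_add]; congr 1; omega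
    have e2 : 6 ^ (d + 1) = 2 ^ d * (6 * 3 ^ d) := by
      rw [pow_succ, show 6 = 2 * 3 from rfl, mul_pow]; ring
    rw [e1, e2] at h2
    exact (Nat.lt_of_mul_lt_mul_left h2).le
  obtain ⟨col, hcol⟩ := comp_bound k d hdk
  refine ⟨col, fun v => ?_⟩
  have h4 : (monoComponent (cp3tree k) col v).ncard ≤ 22 * 3 ^ d := by
    have := hcol v
    have : 1 ≤ 3 ^ d := Nat.one_le_pow _ _ (by norm_num)
    omega
  have h5 : ((monoComponent (cp3tree k) col v).ncard : ℝ) ≤ 22 * 3 ^ d := by exact_mod_cast h4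
  have h6 := num_bound k d h1
  linarith
end

section
/- For every integer k ≥ 0 and each pair of distinct outer vertices v_i, v_j of the complete planar 3-tree T_k with k levels, the vertices v_i and v_j have exactly k common internal neighbors, and these k common neighbors induce a path w_1, w_2, …, w_k in T_k (the central path from the central vertex w_1 of T_1 to a leaf-vertex w_k). -/
theorem cp3corner_inl (s : List (Fin 3)) (x i : Fin 3) :
    cp3corner s x = Sum.inl i ↔ x = i ∧ i ∉ s := by
  induction s with
  | nil => simp [cp3corner]
  | cons j s ih =>
    by_cases h : x = j
    · simp only [cp3corner, h, if_true, List.mem_cons]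
      constructor
      · intro h; cases h
      · rintro ⟨rfl, h⟩; simp at h
    · simp only [cp3corner, h, if_false, ih, List.mem_cons]
      constructor
      · rintro ⟨rfl, h'⟩; simp [h, h']
      · rintro ⟨rfl, h'⟩; simp_all

theorem cp3adj_inl (i : Fin 3) (s : List (Fin 3)) :
    cp3.Adj (Sum.inl i) (Sum.inr s) ↔ i ∉ s := by
  simp [cp3, SimpleGraph.fromRel_adj, cp3corner_inl]

theorem cp3corner_rep (a b : ℕ) (m x : Fin 3) :
    cp3corner (List.replicate a m) x = Sum.inr (List.replicate b m) ↔ x = m ∧ a = b + 1 := by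
  induction a with
  | zero => simp [cp3corner]
  | succ a ih =>
    by_cases h : x = m
    · simp [List.replicate_succ, cp3corner, h]
    · simp [List.replicate_succ, cp3corner, h, ih]

theorem cp3adj_rep (a b : ℕ) (m : Fin 3) :
    cp3.Adj (Sum.inr (List.replicate a m)) (Sum.inr (List.replicate b m)) ↔
      (a + 1 = b ∨ b + 1 = a) := by
  simp [cp3, SimpleGraph.fromRel_adj, cp3corner_rep]
  omega

/-- For every `k ≥ 0` and each pair of distinct outer vertices `v_i, v_j` of the
complete planar 3-tree with `k` levels, the common internal neighbours of `v_i` and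
`v_j` are exactly `k` vertices `w 0, …, w (k-1)`, and they induce a path in `T k`
(vertices being adjacent iff consecutive), starting at the central vertex `w 0` of
`T 1` (the center `Sum.inr []` of the root face) and ending at a leaf-vertex
`w (k-1)` of level `k`. -/
theorem cp3tree_central_path :
    ∀ (k : ℕ) (i j : Fin 3), i ≠ j →
      ∃ w : Fin k → CP3V,
        Function.Injective w ∧
        (∀ u : CP3V,
          (u ∈ cp3verts k ∧ 1 ≤ cp3level u ∧
            cp3.Adj (Sum.inl i) u ∧ cp3.Adj (Sum.inl j) u) ↔ ∃ t : Fin k, w t = u) ∧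
        (∀ s t : Fin k, cp3.Adj (w s) (w t) ↔ (s.1 + 1 = t.1 ∨ t.1 + 1 = s.1)) ∧
        (∀ h : 0 < k,
          w ⟨0, h⟩ = Sum.inr [] ∧ cp3level (w ⟨k - 1, by omega⟩) = k) := by
  intro k i j hij
  obtain ⟨m, hm⟩ : ∃ m : Fin 3, ∀ x, (x ≠ i ∧ x ≠ j) ↔ x = m := by
    revert i j; decide
  refine ⟨fun t => Sum.inr (List.replicate t.1 m), ?_, ?_, ?_, ?_⟩
  · intro s t h
    simpa [Fin.ext_iff] using h
  · rintro (u | s)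
    · simp [cp3level]
    · rw [cp3adj_inl, cp3adj_inl]
      simp only [cp3verts, Set.mem_setOf_eq, cp3level]
      constructor
      · rintro ⟨h1, -, h2, h3⟩
        refine ⟨⟨s.length, by omega⟩, ?_⟩
        congr 1
        symm
        rw [List.eq_replicate_iff]
        refine ⟨rfl, fun x hx => (hm x).1 ⟨?_, ?_⟩⟩
        · rintro rfl; exact h2 hx
        · rintro rfl; exact h3 hx
      · rintro ⟨t, ht⟩
        obtain rfl := Sum.inr.inj ht
        have := (hm m).2 rfl
        refine ⟨?_, by omega, ?_, ?_⟩
        · have := t.2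
          simp
        · intro h; exact this.1 (List.eq_of_mem_replicate h).symm
        · intro h; exact this.2 (List.eq_of_mem_replicate h).symm
  · intro s t
    exact cp3adj_rep _ _ _
  · intro h
    refine ⟨rfl, ?_⟩
    simp [cp3level]; omega
end
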